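/- Let ℙ be a finitely characterized, stationary, ergodic process over a finite alphabet 𝒳 with positive-probability predictive equivalence classes E_1,…,E_N and history ε-machine matrices {T^(x)}. Then for every class E_i and every word w ∈ 𝒳*, the predictive probability equals the word-generation probability of the history ε-machine started in state E_i: 𝐏(w|E_i) = ‖e_i T^(w)‖₁, where T^(w) = T^(w_0)⋯T^(w_{l-1}) for w = w_0…w_{l-1} and e_i is the i-th standard basis vector. -/

import Mathlib

open MeasureTheory Filter Topology
open scoped Classical

namespace EM

variable {X : Type*} [Fintype X] [MeasurableSpace X] [MeasurableSingletonClass X]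

/-- The left shift on bi-infinite sequences. -/
def shift (ω : ℤ → X) : ℤ → X := fun n => ω (n + 1)

/-- ℙ(w): probability of the cylinder set of the word `w` at position 0. -/
noncomputable def wordProb (μ : Measure (ℤ → X)) (w : List X) : ℝ :=
  (μ {ω | ∀ k : Fin w.length, ω ((k : ℕ) : ℤ) = w.get k}).toReal

/-- Stationarity: invariance of the measure under the shift. -/
def Stationary (μ : Measure (ℤ → X)) : Prop := Measure.map shift μ = μ

/-- Ergodicity: every shift-invariant measurable event is trivial. -/
def Ergodic' (μ : Measure (ℤ → X)) : Prop :=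
  ∀ A : Set (ℤ → X), MeasurableSet A → shift ⁻¹' A = A → μ A = 0 ∨ μ A = 1

/-- Projection of a bi-infinite sequence to its past:  (pastMap ω) n = x_{-(n+1)}. -/
def pastMap (ω : ℤ → X) : ℕ → X := fun n => ω (-((n : ℤ) + 1))

/-- ℙ⁻ : the marginal of ℙ on past sequences. -/
noncomputable def pastMeasure (μ : Measure (ℤ → X)) : Measure (ℕ → X) :=
  Measure.map pastMap μ

/-- x⃖^t = x_{-t} … x_{-1}, the last `t` symbols of the past `p`, as a word. -/
def pastWord (p : ℕ → X) (t : ℕ) : List X := (List.range t).reverse.map p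

/-- A past is nontrivial if all of its finite suffixes have positive probability. -/
def Nontrivial' (μ : Measure (ℤ → X)) (p : ℕ → X) : Prop :=
  ∀ t : ℕ, 0 < wordProb μ (pastWord p t)

/-- ℙ(w | v) = ℙ(vw)/ℙ(v): conditional probability that `w` follows `v`. -/
noncomputable def condProb (μ : Measure (ℤ → X)) (w v : List X) : ℝ :=
  wordProb μ (v ++ w) / wordProb μ v

/-- A past is `w`-regular if it is nontrivial and lim_{t→∞} ℙ(w|x⃖^t) exists. -/
def WRegular (μ : Measure (ℤ → X)) (p : ℕ → X) (w : List X) : Prop :=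
  Nontrivial' μ p ∧ ∃ L : ℝ, Tendsto (fun t => condProb μ w (pastWord p t)) atTop (𝓝 L)

/-- A past is regular if it is nontrivial and `w`-regular for every nonempty word `w`. -/
def Regular (μ : Measure (ℤ → X)) (p : ℕ → X) : Prop :=
  Nontrivial' μ p ∧ ∀ w : List X, w ≠ [] →
    ∃ L : ℝ, Tendsto (fun t => condProb μ w (pastWord p t)) atTop (𝓝 L)

/-- 𝐏(w|x⃖) = lim_{t→∞} ℙ(w|x⃖^t)  (meaningful for regular pasts). -/
noncomputable def predProb (μ : Measure (ℤ → X)) (p : ℕ → X) (w : List X) : ℝ :=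
  limUnder atTop (fun t => condProb μ w (pastWord p t))

/-- The past x⃖x obtained by appending the symbol `x` to the past x⃖. -/
def extendPast (p : ℕ → X) (x : X) : ℕ → X
  | 0 => x
  | n + 1 => p n

/-- The past obtained by appending a word symbol by symbol. -/
def extendWord (p : ℕ → X) : List X → (ℕ → X)
  | [] => p
  | x :: u => extendWord (extendPast p x) u

/-- The predictive equivalence class of the (regular) past `p`. -/
def classOf (μ : Measure (ℤ → X)) (p : ℕ → X) : Set (ℕ → X) :=
  {q | Regular μ q ∧ ∀ w : List X, w ≠ [] → predProb μ q w = predProb μ p w}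

section HMM

variable {S : Type*} [Fintype S] [DecidableEq S]

/-- T^(w) = T^(w₀) ⋯ T^(w_{l-1}). -/
def wordMatrix (T : X → Matrix S S ℝ) (w : List X) : Matrix S S ℝ :=
  (w.map T).prod

/-- 𝐏_{σ_i}(w) = ‖e_i T^(w)‖₁, the probability of emitting `w` from state `i`. -/
noncomputable def stateWordProb (T : X → Matrix S S ℝ) (i : S) (w : List X) : ℝ :=
  ∑ j, wordMatrix T w i j

/-- All transition matrices have nonnegative entries. -/
def HMMNonneg (T : X → Matrix S S ℝ) : Prop := ∀ x i j, 0 ≤ T x i j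

/-- The overall transition matrix T = Σ_x T^(x) is row-stochastic. -/
def HMMStochastic (T : X → Matrix S S ℝ) : Prop := ∀ i, ∑ x : X, ∑ j, T x i j = 1

/-- The overall state-to-state transition matrix T = Σ_x T^(x). -/
noncomputable def totalT (T : X → Matrix S S ℝ) : Matrix S S ℝ := ∑ x : X, T x

/-- Irreducibility: the directed graph with an edge i → j whenever T_{ij} > 0 is
strongly connected. -/
def Irreducible' (T : X → Matrix S S ℝ) : Prop :=
  ∀ i j : S, ∃ n : ℕ, 0 < n ∧ 0 < (totalT T ^ n) i j

/-- Unifilarity: from each state, each symbol leads to at most one state. -/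
def Unifilar (T : X → Matrix S S ℝ) : Prop :=
  ∀ (x : X) (i j k : S), 0 < T x i j → 0 < T x i k → j = k

/-- Probabilistically distinct states. -/
def ProbDistinct (T : X → Matrix S S ℝ) : Prop :=
  ∀ i j : S, i ≠ j → ∃ w : List X, w ≠ [] ∧ stateWordProb T i w ≠ stateWordProb T j w

/-- π is a stationary distribution for the HMM: π ≥ 0, Σπ = 1, π = πT. -/
def IsStationaryDist (T : X → Matrix S S ℝ) (π : S → ℝ) : Prop :=
  (∀ i, 0 ≤ π i) ∧ (∑ i, π i = 1) ∧ (∀ j, ∑ i, π i * totalT T i j = π j)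

/-- A generator ε-machine: a valid, irreducible, unifilar HMM with
probabilistically distinct states. -/
def IsGenEM (T : X → Matrix S S ℝ) : Prop :=
  HMMNonneg T ∧ HMMStochastic T ∧ Irreducible' T ∧ Unifilar T ∧ ProbDistinct T

/-- The set of regular pasts whose predictions agree with state `i` of the HMM `T`. -/
def stateClass (μ : Measure (ℤ → X)) (T : X → Matrix S S ℝ) (i : S) : Set (ℕ → X) :=
  {q | Regular μ q ∧ ∀ w : List X, w ≠ [] → predProb μ q w = stateWordProb T i w}

end HMM

/-- The symbol-labeled transition matrices of the history ε-machine, given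
representatives `p i` of the positive-probability predictive equivalence classes:
T^(x)_{ij} = 𝐏(x|E_i) if 𝐏(x|E_i) > 0 and δ_h(E_i,x) = E_j, and 0 otherwise. -/
noncomputable def histT (μ : Measure (ℤ → X)) {N : ℕ} (p : Fin N → (ℕ → X)) (x : X) :
    Matrix (Fin N) (Fin N) ℝ := fun i j =>
  if 0 < predProb μ (p i) [x] ∧ classOf μ (extendPast (p i) x) = classOf μ (p j)
  then predProb μ (p i) [x] else 0

/-- ℙ is finitely characterized, with the pasts `p i` representing the finitely many
positive-probability predictive equivalence classes E_i = classOf μ (p i). -/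
def FinitelyCharacterized (μ : Measure (ℤ → X)) {N : ℕ} (p : Fin N → (ℕ → X)) : Prop :=
  (∀ i, Regular μ (p i)) ∧
  (∀ i j : Fin N, i ≠ j → classOf μ (p i) ≠ classOf μ (p j)) ∧
  (∀ i, 0 < pastMeasure μ (classOf μ (p i))) ∧
  (∑ i, pastMeasure μ (classOf μ (p i)) = 1)

end EM

namespace EM

/-- The cylinder set of sequences which spell out the word `w` from position `m` on. -/
def cyl {X : Type*} (m : ℤ) (w : List X) : Set (ℤ → X) :=
  {ω | ∀ k : Fin w.length, ω (m + ((k : ℕ) : ℤ)) = w.get k}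

theorem cyl_nil {X : Type*} (m : ℤ) : cyl m ([] : List X) = Set.univ := by
  ext ω
  simp [cyl]

theorem cyl_cons {X : Type*} (m : ℤ) (x : X) (w : List X) :
    cyl m (x :: w) = {ω | ω m = x} ∩ cyl (m + 1) w := by
  ext ω
  simp only [cyl, Set.mem_ofPred_eq, Set.mem_inter_iff]
  constructor
  · intro h
    refine ⟨by simpa using h ⟨0, by simp⟩, fun k => ?_⟩
    simpa [add_assoc, add_comm (1 : ℤ)] using h k.succ
  · rintro ⟨h0, h⟩ k
    refine Fin.cases ?_ (fun k => ?_) k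
    · simpa using h0
    · simpa [add_assoc, add_comm (1 : ℤ)] using h k

theorem cyl_append {X : Type*} (m : ℤ) (u v : List X) :
    cyl m (u ++ v) = cyl m u ∩ cyl (m + u.length) v := by
  induction u generalizing m with
  | nil => simp [cyl_nil]
  | cons x u ih =>
    have : m + 1 + (u.length : ℤ) = m + ((u.length : ℤ) + 1) := by ring
    simp only [List.cons_append, cyl_cons, ih, List.length_cons, Nat.cast_add, Nat.cast_one,
      Set.inter_assoc, this]

theorem pastWord_succ {X : Type*} (q : ℕ → X) (t : ℕ) :
    pastWord q (t + 1) = q t :: pastWord q t := by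
  simp [pastWord, List.range_succ]

theorem length_pastWord {X : Type*} (q : ℕ → X) (t : ℕ) : (pastWord q t).length = t := by
  simp [pastWord]

theorem pastWord_extendPast {X : Type*} (q : ℕ → X) (x : X) (t : ℕ) :
    pastWord (extendPast q x) (t + 1) = pastWord q t ++ [x] := by
  induction t with
  | zero => simp [pastWord, extendPast]
  | succ t ih =>
    rw [pastWord_succ, ih, pastWord_succ q t]
    rfl

theorem pastWord_eq_ofFn {X : Type*} (q : ℕ → X) (t : ℕ) :
    pastWord q t = (List.ofFn fun k : Fin t => q k).reverse := by
  have : (List.range t).map q = List.ofFn fun k : Fin t => q k := by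
    apply List.ext_getElem <;> simp
  rw [pastWord, List.map_reverse, this]

theorem mem_cyl_pastWord {X : Type*} (q : ℕ → X) (t : ℕ) (ω : ℤ → X) :
    ω ∈ cyl (-(t : ℤ)) (pastWord q t) ↔ ∀ k < t, pastMap ω k = q k := by
  induction t with
  | zero => simp [pastWord, cyl_nil]
  | succ t ih =>
    have h : -((t + 1 : ℕ) : ℤ) + 1 = -(t : ℤ) := by push_cast; ring
    rw [pastWord_succ, cyl_cons, h, Set.mem_inter_iff, ih, Nat.forall_lt_succ_right, and_comm]
    simp [pastMap]

theorem pastMap_shift {X : Type*} (ω : ℤ → X) :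
    pastMap (shift ω) = extendPast (pastMap ω) (ω 0) := by
  funext n
  cases n with
  | zero => simp [pastMap, shift, extendPast]
  | succ n =>
    simp only [pastMap, shift, extendPast]
    congr 1

section Measurability

variable {X : Type*} [MeasurableSpace X]

theorem measurable_shift : Measurable (shift : (ℤ → X) → (ℤ → X)) :=
  measurable_pi_lambda _ fun n => measurable_pi_apply (n + 1)

theorem measurable_pastMap : Measurable (pastMap : (ℤ → X) → (ℕ → X)) :=
  measurable_pi_lambda _ fun _ => measurable_pi_apply _

theorem measurableSet_cyl [MeasurableSingletonClass X] (m : ℤ) (w : List X) :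
    MeasurableSet (cyl m w) := by
  have : cyl m w = ⋂ k : Fin w.length, (fun ω : ℤ → X => ω (m + ((k : ℕ) : ℤ))) ⁻¹' {w.get k} := by
    ext ω
    simp [cyl]
  rw [this]
  exact MeasurableSet.iInter fun k => measurable_pi_apply _ (measurableSet_singleton _)

theorem measurable_comp_pastWord [Finite X] [MeasurableSingletonClass X] {α : Type*}
    [MeasurableSpace α] (F : List X → α) (t : ℕ) : Measurable fun q : ℕ → X => F (pastWord q t) := by
  have h : Measurable fun y : Fin t → X => F (List.ofFn y).reverse := measurable_of_finite _
  simp only [pastWord_eq_ofFn]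
  exact h.comp (measurable_pi_lambda _ fun k => measurable_pi_apply _)

end Measurability

section Regular

variable {X : Type*} [MeasurableSpace X] {μ : Measure (ℤ → X)}

theorem wordProb_nonneg (w : List X) : 0 ≤ wordProb μ w := ENNReal.toReal_nonneg

theorem condProb_nonneg (w v : List X) : 0 ≤ condProb μ w v :=
  div_nonneg (wordProb_nonneg _) (wordProb_nonneg _)

theorem Regular.tendsto_predProb {q : ℕ → X} (hq : Regular μ q) {w : List X} (hw : w ≠ []) :
    Tendsto (fun t => condProb μ w (pastWord q t)) atTop (𝓝 (predProb μ q w)) := by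
  obtain ⟨L, hL⟩ := hq.2 w hw
  rwa [predProb, hL.limUnder_eq]

theorem Regular.predProb_nonneg {q : ℕ → X} (hq : Regular μ q) {w : List X} (hw : w ≠ []) :
    0 ≤ predProb μ q w :=
  ge_of_tendsto' (hq.tendsto_predProb hw) fun _ => condProb_nonneg _ _

theorem Regular.tendsto_condProb_extendPast {q : ℕ → X}
    (hq : Regular μ q) {x : X} (hx : 0 < predProb μ q [x]) (w : List X) :
    Tendsto (fun t => condProb μ w (pastWord (extendPast q x) t)) atTop
      (𝓝 (predProb μ q (x :: w) / predProb μ q [x])) := by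
  rw [← tendsto_add_atTop_iff_nat 1]
  refine ((hq.tendsto_predProb (w := x :: w) (by simp)).div
    (hq.tendsto_predProb (w := [x]) (by simp)) hx.ne').congr fun t => ?_
  rw [pastWord_extendPast]
  simp only [Pi.div_apply, condProb, List.append_assoc, List.singleton_append]
  exact div_div_div_cancel_right₀ (hq.1 t).ne' _ _

theorem Regular.predProb_extendPast {q : ℕ → X} (hq : Regular μ q)
    {x : X} (hx : 0 < predProb μ q [x]) (w : List X) :
    predProb μ (extendPast q x) w = predProb μ q (x :: w) / predProb μ q [x] :=
  (hq.tendsto_condProb_extendPast hx w).limUnder_eq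

end Regular

section Stationary

variable {X : Type*} [MeasurableSpace X] [MeasurableSingletonClass X] {μ : Measure (ℤ → X)}

theorem Stationary.measureReal_cyl (hstat : Stationary μ) (w : List X) (t : ℕ) :
    μ.real (cyl (-(t : ℤ)) w) = wordProb μ w := by
  have step : ∀ m : ℤ, μ (cyl m w) = μ (cyl (m + 1) w) := by
    intro m
    conv_lhs => rw [← hstat, Measure.map_apply measurable_shift (measurableSet_cyl m w)]
    congr 1
    ext ω
    simp [cyl, shift, add_right_comm]
  have h0 : μ (cyl (-(t : ℤ)) w) = μ (cyl 0 w) := by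
    induction t with
    | zero => simp
    | succ t ih => rw [step, ← ih]; congr 2; push_cast; ring
  rw [Measure.real, h0, wordProb]
  simp [cyl]

variable [IsProbabilityMeasure μ]

theorem Stationary.wordProb_append_le_left (hstat : Stationary μ) (u v : List X) :
    wordProb μ (u ++ v) ≤ wordProb μ u := by
  rw [← hstat.measureReal_cyl _ 0, ← hstat.measureReal_cyl _ 0, cyl_append]
  exact measureReal_mono Set.inter_subset_left

theorem Stationary.wordProb_append_le_right (hstat : Stationary μ) (u v : List X) :
    wordProb μ (u ++ v) ≤ wordProb μ v := by
  rw [← hstat.measureReal_cyl _ u.length, ← hstat.measureReal_cyl v 0, cyl_append]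
  refine measureReal_mono (Set.inter_subset_right.trans ?_)
  simp

theorem Stationary.predProb_cons_le (hstat : Stationary μ) {q : ℕ → X} (hq : Regular μ q) (x : X)
    (w : List X) : predProb μ q (x :: w) ≤ predProb μ q [x] := by
  refine le_of_tendsto_of_tendsto' (hq.tendsto_predProb (by simp)) (hq.tendsto_predProb (by simp))
    fun t => div_le_div_of_nonneg_right ?_ (wordProb_nonneg _)
  simpa using hstat.wordProb_append_le_left (pastWord q t ++ [x]) w

theorem Stationary.nontrivial_extendPast (hstat : Stationary μ) {q : ℕ → X} (hq : Regular μ q)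
    {x : X} (hx : 0 < predProb μ q [x]) : Nontrivial' μ (extendPast q x) := by
  have hev := (hq.tendsto_predProb (w := [x]) (by simp)).eventually (lt_mem_nhds hx)
  obtain ⟨T, hT⟩ := eventually_atTop.1 hev
  have hlarge : ∀ t, T ≤ t → 0 < wordProb μ (pastWord (extendPast q x) (t + 1)) := by
    intro t ht
    rw [pastWord_extendPast]
    refine (wordProb_nonneg _).lt_of_ne' fun h0 => ?_
    have := hT t ht
    simp [condProb, h0] at this
  have hanti : Antitone fun t => wordProb μ (pastWord (extendPast q x) t) := by
    refine antitone_nat_of_succ_le fun t => ?_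
    rw [pastWord_succ]
    exact hstat.wordProb_append_le_right [_] _
  intro t
  exact (hlarge (max T t) (le_max_left _ _)).trans_le
    (hanti ((le_max_right _ _).trans (Nat.le_succ _)))

theorem Stationary.regular_extendPast (hstat : Stationary μ) {q : ℕ → X} (hq : Regular μ q)
    {x : X} (hx : 0 < predProb μ q [x]) : Regular μ (extendPast q x) :=
  ⟨hstat.nontrivial_extendPast hq hx, fun w _ => ⟨_, hq.tendsto_condProb_extendPast hx w⟩⟩

theorem Stationary.condProb_le_one (hstat : Stationary μ) (w v : List X) : condProb μ w v ≤ 1 :=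
  div_le_one_of_le₀ (hstat.wordProb_append_le_left v w) (wordProb_nonneg _)

end Stationary

section Classes

variable {X : Type*} [MeasurableSpace X] {μ : Measure (ℤ → X)}

theorem Regular.mem_classOf {q : ℕ → X} (hq : Regular μ q) : q ∈ classOf μ q :=
  ⟨hq, fun _ _ => rfl⟩

theorem classOf_eq_of_mem {q r : ℕ → X} (h : r ∈ classOf μ q) : classOf μ r = classOf μ q := by
  ext s
  exact and_congr_right fun _ => forall₂_congr fun w hw => by rw [h.2 w hw]

variable [MeasurableSingletonClass X]

theorem measurableSet_classOf [Finite X] (q : ℕ → X) : MeasurableSet (classOf μ q) := by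
  have : classOf μ q = (⋂ t : ℕ, {r | 0 < wordProb μ (pastWord r t)}) ∩
      ⋂ w : {w : List X // w ≠ []},
        {r | Tendsto (fun t => condProb μ w.1 (pastWord r t)) atTop (𝓝 (predProb μ q w.1))} := by
    ext r
    simp only [Set.mem_inter_iff, Set.mem_iInter, Set.mem_ofPred_eq, Subtype.forall]
    constructor
    · rintro ⟨hr, h⟩
      refine ⟨hr.1, fun w hw => ?_⟩
      rw [← h w hw]
      exact hr.tendsto_predProb hw
    · rintro ⟨hn, h⟩
      exact ⟨⟨hn, fun w hw => ⟨_, h w hw⟩⟩, fun w hw => (h w hw).limUnder_eq⟩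
  rw [this]
  refine (MeasurableSet.iInter fun t => ?_).inter (MeasurableSet.iInter fun w => ?_)
  · exact measurableSet_lt measurable_const (measurable_comp_pastWord (wordProb μ) t)
  · exact measurableSet_tendsto _ fun t => measurable_comp_pastWord (condProb μ w.1) t

variable [IsProbabilityMeasure μ]

theorem Stationary.extendPast_mem_classOf (hstat : Stationary μ) {q r : ℕ → X}
    (hq : Regular μ q) {x : X} (hx : 0 < predProb μ q [x]) (hr : r ∈ classOf μ q) :
    extendPast r x ∈ classOf μ (extendPast q x) := by
  have hx' : 0 < predProb μ r [x] := by rwa [hr.2 _ (by simp)]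
  refine ⟨hstat.regular_extendPast hr.1 hx', fun w _ => ?_⟩
  rw [hr.1.predProb_extendPast hx', hq.predProb_extendPast hx,
    hr.2 _ (by simp), hr.2 _ (by simp)]

end Classes

section Prediction

variable {X : Type*}

/-- The last `t` symbols before time zero. -/
def recentPast (t : ℕ) (ω : ℤ → X) : Fin t → X := fun k => pastMap ω k

theorem recentPast_preimage_singleton (t : ℕ) (ω : ℤ → X) :
    recentPast t ⁻¹' {recentPast t ω} = cyl (-(t : ℤ)) (pastWord (pastMap ω) t) := by
  ext η
  rw [mem_cyl_pastWord, Set.mem_preimage, Set.mem_singleton_iff, funext_iff]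
  exact ⟨fun h k hk => h ⟨k, hk⟩, fun h k => h k k.2⟩

variable [MeasurableSpace X]

theorem measurable_recentPast (t : ℕ) : Measurable (recentPast t : (ℤ → X) → (Fin t → X)) :=
  measurable_pi_lambda _ fun _ => measurable_pi_apply _

/-- The filtration whose `t`-th σ-algebra is generated by the last `t` symbols before time zero. -/
def pastFiltration (X : Type*) [MeasurableSpace X] :
    Filtration ℕ (inferInstance : MeasurableSpace (ℤ → X)) where
  seq t := MeasurableSpace.comap (recentPast t) inferInstance
  mono' s t hst := by
    have h : (recentPast s : (ℤ → X) → (Fin s → X)) =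
        (fun y k => y (Fin.castLE hst k)) ∘ recentPast t := rfl
    have hm : Measurable fun (y : Fin t → X) (k : Fin s) => y (Fin.castLE hst k) :=
      measurable_pi_lambda _ fun _ => measurable_pi_apply _
    change MeasurableSpace.comap (recentPast s) _ ≤ _
    rw [h, ← MeasurableSpace.comap_comp]
    exact MeasurableSpace.comap_mono hm.comap_le
  le' t := (measurable_recentPast t).comap_le

theorem measurable_pastMap_iSup_pastFiltration :
    Measurable[⨆ t, pastFiltration X t] (pastMap : (ℤ → X) → (ℕ → X)) := by
  refine @measurable_pi_lambda _ _ _ (⨆ t, pastFiltration X t) _ _ fun k => ?_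
  have h : Measurable[pastFiltration X (k + 1)] fun ω : ℤ → X => pastMap ω k :=
    (measurable_pi_apply (Fin.last k)).comp (comap_measurable (recentPast (k + 1)))
  exact h.mono (le_iSup (fun t => pastFiltration X t) (k + 1)) le_rfl

variable [MeasurableSingletonClass X] {μ : Measure (ℤ → X)} [IsProbabilityMeasure μ]

theorem Stationary.setIntegral_condProb_recentPast (hstat : Stationary μ) (w : List X) (t : ℕ)
    (y : Fin t → X) :
    ∫ ω in recentPast t ⁻¹' {y}, condProb μ w (pastWord (pastMap ω) t) ∂μ =
      ∫ ω in recentPast t ⁻¹' {y}, (cyl 0 w).indicator 1 ω ∂μ := by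
  rcases (recentPast t ⁻¹' {y}).eq_empty_or_nonempty with he | ⟨ω₀, hω₀⟩
  · simp [he]
  obtain rfl : recentPast t ω₀ = y := hω₀
  have hm : MeasurableSet (recentPast t ⁻¹' {recentPast t ω₀} : Set (ℤ → X)) :=
    measurable_recentPast t (measurableSet_singleton _)
  have hc : ∀ ω ∈ recentPast t ⁻¹' {recentPast t ω₀},
      condProb μ w (pastWord (pastMap ω) t) = condProb μ w (pastWord (pastMap ω₀) t) := by
    intro ω hω
    have h : (fun k : Fin t => pastMap ω k) = fun k : Fin t => pastMap ω₀ k := hω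
    rw [pastWord_eq_ofFn, pastWord_eq_ofFn, h]
  rw [setIntegral_congr_fun hm hc, setIntegral_const,
    integral_indicator_one (measurableSet_cyl 0 w),
    measureReal_restrict_apply (measurableSet_cyl 0 w), recentPast_preimage_singleton,
    hstat.measureReal_cyl, Set.inter_comm]
  have h := cyl_append (-(t : ℤ)) (pastWord (pastMap ω₀) t) w
  rw [length_pastWord, neg_add_cancel] at h
  rw [← h, hstat.measureReal_cyl, smul_eq_mul, condProb]
  refine mul_div_cancel_of_imp' fun h0 => ?_
  exact le_antisymm ((hstat.wordProb_append_le_left _ _).trans_eq h0) (wordProb_nonneg _)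

variable [Finite X]

theorem measurable_pastFiltration_comp_pastWord (F : List X → ℝ) (t : ℕ) :
    Measurable[pastFiltration X t] fun ω : ℤ → X => F (pastWord (pastMap ω) t) := by
  have h : Measurable fun y : Fin t → X => F (List.ofFn y).reverse := measurable_of_finite _
  simp only [pastWord_eq_ofFn]
  exact h.comp (comap_measurable (recentPast t))

theorem Stationary.integrable_condProb (hstat : Stationary μ) (w : List X) (t : ℕ) :
    Integrable (fun ω => condProb μ w (pastWord (pastMap ω) t)) μ := by
  refine Integrable.of_bound (C := 1)
    ((measurable_comp_pastWord (condProb μ w) t).comp measurable_pastMap).aestronglyMeasurable ?_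
  refine Eventually.of_forall fun ω => ?_
  rw [Real.norm_of_nonneg (condProb_nonneg _ _)]
  exact hstat.condProb_le_one _ _

theorem Stationary.condProb_ae_eq_condExp (hstat : Stationary μ) (w : List X) (t : ℕ) :
    (fun ω => condProb μ w (pastWord (pastMap ω) t)) =ᵐ[μ]
      μ[(cyl 0 w).indicator (1 : (ℤ → X) → ℝ) | pastFiltration X t] := by
  have hind : Integrable ((cyl 0 w).indicator (1 : (ℤ → X) → ℝ)) μ :=
    (integrable_const (1 : ℝ)).indicator (measurableSet_cyl 0 w)
  refine ae_eq_condExp_of_forall_setIntegral_eq ((pastFiltration X).le t) hind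
    (fun s _ _ => (hstat.integrable_condProb w t).integrableOn) ?_
    (measurable_pastFiltration_comp_pastWord _ t).stronglyMeasurable.aestronglyMeasurable
  rintro s ⟨B, -, rfl⟩ -
  have := Fintype.ofFinite X
  have hB : (recentPast t ⁻¹' B : Set (ℤ → X)) =
      ⋃ y ∈ B.toFinset, recentPast t ⁻¹' {y} := by
    ext ω
    simp
  have hmeas : ∀ y ∈ B.toFinset, MeasurableSet (recentPast t ⁻¹' {y} : Set (ℤ → X)) :=
    fun y _ => measurable_recentPast t (measurableSet_singleton y)
  have hdisj : Set.Pairwise (↑B.toFinset)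
      (Function.onFun Disjoint fun y : Fin t → X => (recentPast t ⁻¹' {y} : Set (ℤ → X))) :=
    fun y _ z _ hyz => Disjoint.preimage _ (Set.disjoint_singleton.2 hyz)
  rw [hB, integral_biUnion_finset _ hmeas hdisj
      fun _ _ => (hstat.integrable_condProb w t).integrableOn,
    integral_biUnion_finset _ hmeas hdisj fun _ _ => hind.integrableOn]
  exact Finset.sum_congr rfl fun y _ => hstat.setIntegral_condProb_recentPast w t y

/-- On a set of pasts on which the predictions of `w` converge to a constant `c`, that constant is
the conditional probability of `w`. -/
theorem Stationary.measureReal_inter_cyl (hstat : Stationary μ) (w : List X) {A : Set (ℕ → X)}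
    (hA : MeasurableSet A) {c : ℝ}
    (hc : ∀ q ∈ A, Tendsto (fun t => condProb μ w (pastWord q t)) atTop (𝓝 c)) :
    μ.real (pastMap ⁻¹' A ∩ cyl 0 w) = μ.real (pastMap ⁻¹' A) * c := by
  have hA' : MeasurableSet (pastMap ⁻¹' A : Set (ℤ → X)) := measurable_pastMap hA
  have hind : Integrable ((cyl 0 w).indicator (1 : (ℤ → X) → ℝ)) μ :=
    (integrable_const (1 : ℝ)).indicator (measurableSet_cyl 0 w)
  have hle : ⨆ t, pastFiltration X t ≤ (inferInstance : MeasurableSpace (ℤ → X)) :=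
    iSup_le fun t => (pastFiltration X).le t
  have hlim := tendsto_ae_condExp (μ := μ) (ℱ := pastFiltration X)
    ((cyl 0 w).indicator (1 : (ℤ → X) → ℝ))
  have heq : ∀ᵐ ω ∂μ, ∀ t, condProb μ w (pastWord (pastMap ω) t) =
      (μ[(cyl 0 w).indicator (1 : (ℤ → X) → ℝ) | pastFiltration X t]) ω :=
    ae_all_iff.2 fun t => hstat.condProb_ae_eq_condExp w t
  have h1 : ∫ ω in pastMap ⁻¹' A,
      (μ[(cyl 0 w).indicator (1 : (ℤ → X) → ℝ) | ⨆ t, pastFiltration X t]) ω ∂μ =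
      ∫ _ in pastMap ⁻¹' A, c ∂μ := by
    refine setIntegral_congr_ae hA' ?_
    filter_upwards [hlim, heq] with ω h1 h2 hω
    refine tendsto_nhds_unique h1 ?_
    simp only [← h2]
    exact hc _ hω
  rw [setIntegral_condExp hle hind (measurable_pastMap_iSup_pastFiltration hA),
    integral_indicator_one (measurableSet_cyl 0 w),
    measureReal_restrict_apply (measurableSet_cyl 0 w), setIntegral_const, smul_eq_mul,
    Set.inter_comm] at h1
  exact h1

theorem Stationary.pastMeasure_classOf_extendPast_pos (hstat : Stationary μ) {q : ℕ → X}
    (hq : Regular μ q) (hpos : 0 < pastMeasure μ (classOf μ q)) {x : X}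
    (hx : 0 < predProb μ q [x]) : 0 < pastMeasure μ (classOf μ (extendPast q x)) := by
  rw [pastMeasure, Measure.map_apply measurable_pastMap (measurableSet_classOf _)] at hpos ⊢
  have h := hstat.measureReal_inter_cyl [x] (measurableSet_classOf (μ := μ) q)
    (c := predProb μ q [x]) fun r hr => by
      rw [← hr.2 [x] (by simp)]
      exact hr.1.tendsto_predProb (by simp)
  have hreal : 0 < μ.real (pastMap ⁻¹' classOf μ q ∩ cyl 0 [x]) := by
    rw [h]
    exact mul_pos (ENNReal.toReal_pos hpos.ne' (measure_ne_top _ _)) hx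
  have hsub : pastMap ⁻¹' classOf μ q ∩ cyl 0 [x] ⊆
      shift ⁻¹' (pastMap ⁻¹' classOf μ (extendPast q x)) := by
    rintro ω ⟨hω, hω0⟩
    have h0 : ω 0 = x := by simpa [cyl_cons, cyl_nil] using hω0
    rw [Set.mem_preimage, Set.mem_preimage, pastMap_shift, h0]
    exact hstat.extendPast_mem_classOf hq hx hω
  have hshift : μ (shift ⁻¹' (pastMap ⁻¹' classOf μ (extendPast q x))) =
      μ (pastMap ⁻¹' classOf μ (extendPast q x)) := by
    rw [← Measure.map_apply measurable_shift (measurable_pastMap (measurableSet_classOf _)), hstat]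
  rw [← hshift]
  exact (ENNReal.toReal_pos_iff.1 hreal).1.trans_le (measure_mono hsub)

theorem FinitelyCharacterized.exists_classOf_eq {N : ℕ} {p : Fin N → (ℕ → X)}
    (hfc : FinitelyCharacterized μ p) {q : ℕ → X} (hpos : 0 < pastMeasure μ (classOf μ q)) :
    ∃ j, classOf μ q = classOf μ (p j) := by
  have : IsProbabilityMeasure (pastMeasure μ) :=
    Measure.isProbabilityMeasure_map measurable_pastMap.aemeasurable
  obtain ⟨-, hne, -, hsum⟩ := hfc
  by_contra! hcon
  have hdisj_of_ne : ∀ {r s : ℕ → X}, classOf μ r ≠ classOf μ s →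
      Disjoint (classOf μ r) (classOf μ s) := fun hrs =>
    Set.disjoint_left.2 fun z hz hz' =>
      hrs ((classOf_eq_of_mem hz).symm.trans (classOf_eq_of_mem hz'))
  have hU : pastMeasure μ (⋃ j, classOf μ (p j)) = 1 := by
    rw [measure_iUnion (fun i j hij => hdisj_of_ne (hne i j hij))
      fun j => measurableSet_classOf _, tsum_fintype, hsum]
  have hd : Disjoint (classOf μ q) (⋃ j, classOf μ (p j)) :=
    Set.disjoint_iUnion_right.2 fun j => hdisj_of_ne (hcon j)
  have hc : pastMeasure μ (⋃ j, classOf μ (p j))ᶜ = 0 :=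
    (prob_compl_eq_zero_iff (MeasurableSet.iUnion fun j => measurableSet_classOf _)).2 hU
  exact hpos.ne' (measure_mono_null hd.subset_compl_right hc)

end Prediction

theorem stateWordProb_nil {X S : Type*} [Fintype S] [DecidableEq S] (T : X → Matrix S S ℝ)
    (i : S) : stateWordProb T i [] = 1 := by
  simp [stateWordProb, wordMatrix, Matrix.one_apply]

theorem stateWordProb_cons {X S : Type*} [Fintype S] [DecidableEq S] (T : X → Matrix S S ℝ)
    (i : S) (x : X) (w : List X) :
    stateWordProb T i (x :: w) = ∑ j, T x i j * stateWordProb T j w := by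
  simp only [stateWordProb, wordMatrix, List.map_cons, List.prod_cons, Matrix.mul_apply,
    Finset.mul_sum]
  exact Finset.sum_comm

/-- For every positive-probability class E_i and word w,
𝐏(w|E_i) = ‖e_i T^(w)‖₁, the word-generation probability of the history ε-machine
started in state E_i. -/
theorem history_class_word_prob
    {X : Type*} [Fintype X] [MeasurableSpace X] [MeasurableSingletonClass X]
    {N : ℕ} (μ : Measure (ℤ → X)) [IsProbabilityMeasure μ]
    (hstat : Stationary μ) (herg : Ergodic' μ)
    (p : Fin N → (ℕ → X)) (hfc : FinitelyCharacterized μ p) :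
    ∀ (i : Fin N) (w : List X), w ≠ [] →
      predProb μ (p i) w = stateWordProb (histT μ p) i w := by
  intro i w hw
  induction w generalizing i with
  | nil => exact absurd rfl hw
  | cons x u ih =>
    have hreg := hfc.1 i
    rw [stateWordProb_cons]
    rcases (hreg.predProb_nonneg (w := [x]) (by simp)).eq_or_lt with hx | hx
    · have h0 : predProb μ (p i) (x :: u) = 0 :=
        le_antisymm ((hstat.predProb_cons_le hreg x u).trans_eq hx.symm)
          (hreg.predProb_nonneg (by simp))
      simp [h0, histT, ← hx]
    · obtain ⟨j, hj⟩ := hfc.exists_classOf_eq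
        (hstat.pastMeasure_classOf_extendPast_pos hreg (hfc.2.2.1 i) hx)
      have hT : ∀ k, histT μ p x i k = if k = j then predProb μ (p i) [x] else 0 := by
        intro k
        have hk : classOf μ (p j) = classOf μ (p k) ↔ k = j :=
          ⟨fun h => by_contra fun hkj => hfc.2.1 k j hkj h.symm, fun h => by rw [h]⟩
        simp only [histT, hx, true_and, hj, hk]
      simp only [hT, ite_mul, zero_mul, Finset.sum_ite_eq', Finset.mem_univ, if_true]
      rcases eq_or_ne u [] with rfl | hu
      · rw [stateWordProb_nil, mul_one]
      · have hmem : p j ∈ classOf μ (extendPast (p i) x) := hj ▸ (hfc.1 j).mem_classOf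
        rw [← ih j hu, hmem.2 u hu, hreg.predProb_extendPast hx, mul_div_cancel₀ _ hx.ne']

end EM
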